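/- arXiv:2408.13548 — 10 statements merged into one kernel-verified Lean document; each statement's English description precedes it below -/
import Mathlib

section
/- Let A be an abelian category and let (U, V) be a complete cotorsion pair in A. Then every morphism h: X → Y in A factors as h = g ∘ f, where f is a monomorphism with Coker(f) ∈ U and g is an epimorphism with Ker(g) ∈ V. -/
open CategoryTheory CategoryTheory.Limits

universe v u

section GeneralDefs

variable {C : Type u} [Category.{v} C]

/-- `HasLift l r` means `l` has the left lifting property with respect to `r`
(equivalently `r` has the right lifting property with respect to `l`): written `l □ r`. -/
def HasLift {X Y Z W : C} (l : X ⟶ Y) (r : Z ⟶ W) : Prop :=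
  ∀ (f : X ⟶ Z) (g : Y ⟶ W), l ≫ g = f ≫ r →
    ∃ t : Y ⟶ Z, l ≫ t = f ∧ t ≫ r = g

/-- `(L, R)` is a weak factorization system: `L = ^□R`, `R = L^□`, and every morphism
factors as a morphism in `L` followed by a morphism in `R`. -/
def IsWFS (L R : MorphismProperty C) : Prop :=
  (∀ {X Y : C} (f : X ⟶ Y), L f ↔ ∀ {Z W : C} (r : Z ⟶ W), R r → HasLift f r) ∧
  (∀ {X Y : C} (g : X ⟶ Y), R g ↔ ∀ {Z W : C} (l : Z ⟶ W), L l → HasLift l g) ∧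
  (∀ {X Y : C} (h : X ⟶ Y), ∃ (Z : C) (f : X ⟶ Z) (g : Z ⟶ Y), L f ∧ R g ∧ f ≫ g = h)

/-- `L` satisfies the left cancellation property: `β ∘ α ∈ L` and `β ∈ L` imply `α ∈ L`. -/
def LeftCancel (L : MorphismProperty C) : Prop :=
  ∀ {X Y Z : C} (α : X ⟶ Y) (β : Y ⟶ Z), L (α ≫ β) → L β → L α

/-- `R` satisfies the right cancellation property: `β ∘ α ∈ R` and `α ∈ R` imply `β ∈ R`. -/
def RightCancel (R : MorphismProperty C) : Prop :=
  ∀ {X Y Z : C} (α : X ⟶ Y) (β : Y ⟶ Z), R (α ≫ β) → R α → R β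

/-- The weak factorization systems `(L, Rt)` and `(Lt, R)` are compatible:
(CP1) `Lt ⊆ L`; (CP2) two-out-of-three for `Rt` among composable morphisms of `R`;
(CP3) if `l ∈ Lt`, `r ∈ R` and `r ∘ l ∈ Lt` then `r ∈ Rt`. -/
def CompatWFS (L Rt Lt R : MorphismProperty C) : Prop :=
  (∀ {X Y : C} (f : X ⟶ Y), Lt f → L f) ∧
  (∀ {X Y Z : C} (α : X ⟶ Y) (β : Y ⟶ Z), R α → R β →
    (Rt α → Rt β → Rt (α ≫ β)) ∧ (Rt α → Rt (α ≫ β) → Rt β) ∧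
    (Rt β → Rt (α ≫ β) → Rt α)) ∧
  (∀ {X Y Z : C} (l : X ⟶ Y) (r : Y ⟶ Z), Lt l → R r → Lt (l ≫ r) → Rt r)

end GeneralDefs

section AbelianDefs

variable {A : Type u} [Category.{v} A] [Abelian A]

/-- `0 → X → Y → Z → 0` is a short exact sequence. -/
def IsSES {X Y Z : A} (i : X ⟶ Y) (p : Y ⟶ Z) : Prop :=
  ∃ w : i ≫ p = 0, (ShortComplex.mk i p w).ShortExact

/-- `Mon(U)`: monomorphisms with cokernel in `U`. -/
def MonCl (U : A → Prop) : MorphismProperty A :=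
  fun _ _ f => Mono f ∧ U (cokernel f)

/-- `Epi(V)`: epimorphisms with kernel in `V`. -/
def EpiCl (V : A → Prop) : MorphismProperty A :=
  fun _ _ g => Epi g ∧ V (kernel g)

/-- `(U, V)` is a complete cotorsion pair: both classes are closed under isomorphisms and
direct summands, every short exact sequence `0 → V' → E → U' → 0` with `U' ∈ U`, `V' ∈ V`
splits (i.e. `Ext^1(U, V) = 0`), and every object admits the two approximation sequences. -/
structure IsCompleteCotorsionPair (U V : A → Prop) : Prop where
  isoU : ∀ {X Y : A}, (X ≅ Y) → U X → U Y
  isoV : ∀ {X Y : A}, (X ≅ Y) → V X → V Y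
  summandU : ∀ {X Z : A} (i : X ⟶ Z) (r : Z ⟶ X), i ≫ r = 𝟙 X → U Z → U X
  summandV : ∀ {X Z : A} (i : X ⟶ Z) (r : Z ⟶ X), i ≫ r = 𝟙 X → V Z → V X
  ext_zero : ∀ {V' E U' : A} (i : V' ⟶ E) (p : E ⟶ U'),
    V V' → U U' → IsSES i p → ∃ s : E ⟶ V', i ≫ s = 𝟙 V'
  complete_left : ∀ C : A, ∃ (V' U' : A) (i : V' ⟶ U') (p : U' ⟶ C),
    U U' ∧ V V' ∧ IsSES i p
  complete_right : ∀ C : A, ∃ (V' U' : A) (i : C ⟶ V') (p : V' ⟶ U'),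
    U U' ∧ V V' ∧ IsSES i p

end AbelianDefs

variable {A : Type u} [Category.{v} A] [Abelian A]

theorem IsSES.nonempty_iso_kernel {X Y Z : A} {i : X ⟶ Y} {p : Y ⟶ Z} (h : IsSES i p) :
    Nonempty (X ≅ kernel p) := by
  obtain ⟨w, h⟩ := h
  exact ⟨h.fIsKernel.conePointUniqueUpToIso (limit.isLimit _)⟩

theorem IsSES.nonempty_iso_cokernel {X Y Z : A} {i : X ⟶ Y} {p : Y ⟶ Z} (h : IsSES i p) :
    Nonempty (Z ≅ cokernel i) := by
  obtain ⟨w, h⟩ := h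
  exact ⟨h.gIsCokernel.coconePointUniqueUpToIso (colimit.isColimit _)⟩

theorem isSES_kernel_ι {X Y : A} (p : X ⟶ Y) [Epi p] : IsSES (kernel.ι p) p :=
  ⟨kernel.condition p,
    { exact := ShortComplex.exact_of_f_is_kernel _ (kernelIsKernel p) }⟩

/-- If `f ≫ g` is a monomorphism and `g` an epimorphism, then the kernel of `g` embeds in the
cokernel of `f`, with quotient the cokernel of `f ≫ g`. -/
theorem isSES_kernelCokernelComp_δ {X Y Z : A} (f : X ⟶ Y) (g : Y ⟶ Z) [Mono (f ≫ g)] [Epi g] :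
    IsSES (kernelCokernelCompSequence.δ f g)
      (cokernel.map f (f ≫ g) (𝟙 _) g (by simp)) := by
  have hex := kernelCokernelCompSequence_exact f g
  have h₁ : (ShortComplex.mk (kernel.map (f ≫ g) g f (𝟙 _) (by simp))
    (kernelCokernelCompSequence.δ f g) (hex.zero 1)).Exact := hex.exact 1
  have h₂ : (ShortComplex.mk (kernelCokernelCompSequence.δ f g)
    (cokernel.map f (f ≫ g) (𝟙 _) g (by simp)) (hex.zero 2)).Exact := hex.exact 2
  have h₃ : (ShortComplex.mk (cokernel.map f (f ≫ g) (𝟙 _) g (by simp))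
    (cokernel.map (f ≫ g) g f (𝟙 _) (by simp)) (hex.zero 3)).Exact := hex.exact 3
  exact ⟨_, { exact := h₂
              mono_f := h₁.mono_g ((isZero_kernel_of_mono (f ≫ g)).eq_of_src _ _)
              epi_g := h₃.epi_f ((isZero_cokernel_of_epi g).eq_of_tgt _ _) }⟩

/-- If `g` is a monomorphism, the cokernel of `f ≫ g` is an extension of the cokernel of `g`
by the cokernel of `f`. -/
theorem isSES_cokernel_comp {X Y Z : A} (f : X ⟶ Y) (g : Y ⟶ Z) [Mono g] :
    IsSES (cokernel.map f (f ≫ g) (𝟙 _) g (by simp))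
      (cokernel.map (f ≫ g) g f (𝟙 _) (by simp)) := by
  have hex := kernelCokernelCompSequence_exact f g
  have h₂ : (ShortComplex.mk (kernelCokernelCompSequence.δ f g)
    (cokernel.map f (f ≫ g) (𝟙 _) g (by simp)) (hex.zero 2)).Exact := hex.exact 2
  have h₃ : (ShortComplex.mk (cokernel.map f (f ≫ g) (𝟙 _) g (by simp))
    (cokernel.map (f ≫ g) g f (𝟙 _) (by simp)) (hex.zero 3)).Exact := hex.exact 3
  have : Epi (cokernel.map (f ≫ g) g f (𝟙 _) (by simp)) :=
    epi_of_epi_fac (cokernel.π_desc (f ≫ g) (𝟙 Z ≫ cokernel.π g) (by simp))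
  exact ⟨_, { exact := h₃
              mono_f := h₂.mono_g ((isZero_kernel_of_mono g).eq_of_src _ _) }⟩

namespace IsCompleteCotorsionPair

variable {U V : A → Prop}

theorem exists_section (hUV : IsCompleteCotorsionPair U V) {E W : A} (p : E ⟶ W) [Epi p]
    (hV : V (kernel p)) (hW : U W) : ∃ s : W ⟶ E, s ≫ p = 𝟙 W := by
  obtain ⟨r, hr⟩ := hUV.ext_zero _ p hV hW (isSES_kernel_ι p)
  obtain ⟨w, h⟩ := isSES_kernel_ι p
  let σ := ShortComplex.Splitting.ofExactOfRetraction _ h.exact r hr h.epi_g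
  exact ⟨σ.s, σ.s_g⟩

theorem exists_lift (hUV : IsCompleteCotorsionPair U V) {E F W : A} (p : F ⟶ E) [Epi p]
    (hV : V (kernel p)) (hW : U W) (x : W ⟶ E) : ∃ s : W ⟶ F, s ≫ p = x := by
  have sq := IsPullback.of_hasPullback p x
  have := isIso_kernel_map_of_isPullback sq.flip
  obtain ⟨s, hs⟩ := hUV.exists_section (pullback.snd p x)
    (hUV.isoV (asIso (kernel.map _ _ _ _ sq.flip.w)).symm hV) hW
  exact ⟨s ≫ pullback.fst p x, by rw [Category.assoc, pullback.condition, reassoc_of% hs]⟩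

theorem mem_left_of_isSES (hUV : IsCompleteCotorsionPair U V) {U₁ E U₂ : A} {a : U₁ ⟶ E}
    {b : E ⟶ U₂} (h : IsSES a b) (h₁ : U U₁) (h₂ : U U₂) : U E := by
  obtain ⟨V', U', i, p, hU', hV', hip⟩ := hUV.complete_left E
  have : Epi p := hip.2.epi_g
  have : Mono a := h.2.mono_f
  have hK : V (kernel p) := hUV.isoV hip.nonempty_iso_kernel.some hV'
  obtain ⟨s, rfl⟩ := hUV.exists_lift p hK h₁ a
  obtain ⟨r, hr⟩ := hUV.ext_zero _ _ hK (hUV.isoU h.nonempty_iso_cokernel.some h₂)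
    (isSES_kernelCokernelComp_δ s p)
  let σ := ShortComplex.Splitting.ofExactOfRetraction _ (isSES_kernel_ι p).2.exact
    (-(cokernel.π s ≫ r)) (by simpa [kernelCokernelCompSequence.δ_fac] using hr) ‹Epi p›
  exact hUV.summandU σ.s p σ.s_g hU'

theorem exists_factorization_of_epi (hUV : IsCompleteCotorsionPair U V) {X Y : A} (e : X ⟶ Y)
    [Epi e] : ∃ (Z : A) (f : X ⟶ Z) (g : Z ⟶ Y),
      Mono f ∧ U (cokernel f) ∧ Epi g ∧ V (kernel g) ∧ f ≫ g = e := by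
  obtain ⟨V', U', i, p, hU', hV', hip⟩ := hUV.complete_right (kernel e)
  have : Mono i := hip.2.mono_f
  have sq := IsPushout.of_hasPushout (kernel.ι e) i
  have := isIso_cokernel_map_of_isPushout sq.flip
  let g : pushout (kernel.ι e) i ⟶ Y := pushout.desc e 0 (by simp)
  have hg : pushout.inl (kernel.ι e) i ≫ g = e := pushout.inl_desc _ _ _
  have w : pushout.inr (kernel.ι e) i ≫ g = 0 := pushout.inr_desc _ _ _
  have : Epi g := epi_of_epi_fac hg
  have hc : IsColimit (CokernelCofork.ofπ g w) :=
    CokernelCofork.IsColimit.ofπ' _ _ fun k hk ↦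
      ⟨(isSES_kernel_ι e).2.exact.desc (pushout.inl _ _ ≫ k) (by
        simp [pushout.condition_assoc, hk]), by
        apply pushout.hom_ext
        · rw [reassoc_of% hg]
          exact (isSES_kernel_ι e).2.exact.g_desc _ _
        · rw [reassoc_of% w, zero_comp, hk]⟩
  have hses : IsSES (pushout.inr (kernel.ι e) i) g :=
    ⟨w, { exact := ShortComplex.exact_of_g_is_cokernel _ hc }⟩
  refine ⟨_, pushout.inl (kernel.ι e) i, g, inferInstance, ?_, this,
    hUV.isoV hses.nonempty_iso_kernel.some hV', hg⟩
  exact hUV.isoU (hip.nonempty_iso_cokernel.some ≪≫ asIso (cokernel.map _ _ _ _ sq.flip.w)) hU'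

end IsCompleteCotorsionPair

/-- Every morphism in an abelian category with a complete cotorsion pair `(U, V)`
factors as a monomorphism with cokernel in `U` followed by an epimorphism with
kernel in `V`. -/
theorem stmt0 (U V : A → Prop) (hUV : IsCompleteCotorsionPair U V)
    {X Y : A} (h : X ⟶ Y) :
    ∃ (Z : A) (f : X ⟶ Z) (g : Z ⟶ Y),
      Mono f ∧ U (cokernel f) ∧ Epi g ∧ V (kernel g) ∧ f ≫ g = h := by
  obtain ⟨V', U', i, p, hU', hV', hip⟩ := hUV.complete_left Y
  have : Epi p := hip.2.epi_g
  have hinr : biprod.inr ≫ biprod.desc h p = p := biprod.inr_desc h p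
  have : Epi (biprod.desc h p) := epi_of_epi_fac hinr
  obtain ⟨Z, f, g, hf, hfU, hg, hgV, hfg⟩ :=
    hUV.exists_factorization_of_epi (biprod.desc h p)
  have hinl : IsSES (biprod.inl : X ⟶ X ⊞ U') biprod.snd :=
    ⟨by simp, (ShortComplex.Splitting.ofHasBinaryBiproduct X U').shortExact⟩
  exact ⟨Z, biprod.inl ≫ f, g, inferInstance,
    hUV.mem_left_of_isSES (isSES_cokernel_comp _ _)
      (hUV.isoU hinl.nonempty_iso_cokernel.some hU') hfU, hg, hgV, by simp [hfg]⟩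
end

section
/- Let A be an abelian category and let (U, V) be a complete cotorsion pair in A. Then Mon(U) = ^□(Epi(V)), i.e., a morphism h lies in Mon(U) if and only if h has the left lifting property with respect to every morphism in Epi(V). -/
open CategoryTheory CategoryTheory.Limits

universe v u

variable {A : Type u} [Category.{v} A] [Abelian A]

/-- If `h = k ≫ r` is a monomorphism and `r` is an epimorphism with kernel `ι`, then
`0 → K → coker k → coker h → 0` is a short exact sequence. -/
theorem IsSES.cokernel_of_comp {X P Y K : A} (ι : K ⟶ P) (r : P ⟶ Y) (k : X ⟶ P) (h : X ⟶ Y)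
    [Mono h] (hι : IsSES ι r) (hk : k ≫ r = h) :
    IsSES (ι ≫ cokernel.π k)
      (cokernel.desc k (r ≫ cokernel.π h) (by rw [reassoc_of% hk, cokernel.condition])) := by
  obtain ⟨w, hS⟩ := hι
  have : Mono ι := hS.mono_f
  have : Epi r := hS.epi_g
  have hmono : Mono k := by
    have : Mono (k ≫ r) := by rw [hk]; infer_instance
    exact mono_of_mono k r
  have exact_coker : ∀ {M N : A} (f : M ⟶ N) [Mono f] {T : A} (a : T ⟶ N),
      a ≫ cokernel.π f = 0 → ∃ b : T ⟶ M, b ≫ f = a := fun f _ _ a ha =>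
    ⟨Abelian.monoLift f a ha, Abelian.monoLift_comp f a ha⟩
  refine ⟨by simp [reassoc_of% w], ShortComplex.ShortExact.mk' ?_ ?_ ?_⟩
  · rw [ShortComplex.exact_iff_exact_up_to_refinements]
    intro T a ha
    obtain ⟨T', e, he, a', ha'⟩ := surjective_up_to_refinements_of_epi (cokernel.π k) a
    have h1 : (a' ≫ r) ≫ cokernel.π h = 0 := by
      have h2 := congrArg (fun z => z ≫ cokernel.desc k (r ≫ cokernel.π h)
        (by rw [reassoc_of% hk, cokernel.condition])) ha'
      dsimp at h2 ha
      simp only [Category.assoc, cokernel.π_desc, ha, comp_zero] at h2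
      simp [← h2]
    obtain ⟨b, hb⟩ := exact_coker h _ h1
    have h3 : (a' - b ≫ k) ≫ r = 0 := by simp [hk, hb]
    refine ⟨T', e, he, hS.exact.lift (a' - b ≫ k) h3, ?_⟩
    have h4 := hS.exact.lift_f (a' - b ≫ k) h3
    dsimp at h4 ⊢
    rw [reassoc_of% h4, ha']
    simp
  · refine Preadditive.mono_of_cancel_zero _ fun {T} a ha => ?_
    obtain ⟨b, hb⟩ := exact_coker k (a ≫ ι) (by simpa using ha)
    have hb0 : b = 0 := by
      rw [← cancel_mono h, ← hk, reassoc_of% hb, w]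
      simp
    rw [← cancel_mono ι, ← hb, hb0]
    simp
  · have : Epi (cokernel.π k ≫ cokernel.desc k (r ≫ cokernel.π h)
        (by rw [reassoc_of% hk, cokernel.condition])) := by
      rw [cokernel.π_desc]; infer_instance
    exact epi_of_epi (cokernel.π k) _

/-- The base change of an epimorphism `r` has the same kernel as `r`. -/
theorem IsSES.of_pullback {Z W Y : A} (r : Z ⟶ W) [Epi r] (g : Y ⟶ W) :
    IsSES (pullback.lift (f := r) (g := g) (kernel.ι r) 0 (by simp)) (pullback.snd r g) := by
  refine ⟨pullback.lift_snd _ _ _, ShortComplex.ShortExact.mk' ?_ ?_ ?_⟩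
  · rw [ShortComplex.exact_iff_exact_up_to_refinements]
    intro T a ha
    dsimp at a ha
    refine ⟨T, 𝟙 T, inferInstance, kernel.lift r (a ≫ pullback.fst r g)
      (by rw [Category.assoc, pullback.condition, ← Category.assoc, ha, zero_comp]), ?_⟩
    dsimp
    apply pullback.hom_ext
    · rw [Category.assoc, Category.assoc, pullback.lift_fst, kernel.lift_ι, Category.id_comp]
    · rw [Category.assoc, Category.assoc, pullback.lift_snd, comp_zero, Category.id_comp, ha]
  · have : Mono (pullback.lift (f := r) (g := g) (kernel.ι r) 0 (by simp) ≫
        pullback.fst r g) := by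
      rw [pullback.lift_fst]; infer_instance
    exact mono_of_mono _ (pullback.fst r g)
  · dsimp; infer_instance

/-- A morphism `k` whose composite with `r` is in `Mon(U)` extends along it to a section of `r`,
if `r` is an epimorphism with kernel in `V`. -/
theorem IsCompleteCotorsionPair.exists_section_s1 {U V : A → Prop}
    (hUV : IsCompleteCotorsionPair U V) {X P Y K : A} {h : X ⟶ Y} (hh : MonCl U h)
    {ι : K ⟶ P} {r : P ⟶ Y} (hι : IsSES ι r) (hK : V K) (k : X ⟶ P) (hk : k ≫ r = h) :
    ∃ s : Y ⟶ P, h ≫ s = k ∧ s ≫ r = 𝟙 Y := by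
  have : Mono h := hh.1
  obtain ⟨ρ, hρ⟩ := hUV.ext_zero _ _ hK hh.2 (IsSES.cokernel_of_comp ι r k h hι hk)
  obtain ⟨w, hS⟩ := hι
  have : Epi r := hS.epi_g
  have h0 : ι ≫ (𝟙 P - cokernel.π k ≫ ρ ≫ ι) = 0 := by
    have := reassoc_of% hρ
    simp [this]
  have hd := hS.exact.g_desc (𝟙 P - cokernel.π k ≫ ρ ≫ ι) h0
  generalize hS.exact.desc (𝟙 P - cokernel.π k ≫ ρ ≫ ι) h0 = s at hd
  dsimp at s hd
  refine ⟨s, ?_, ?_⟩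
  · rw [← hk, Category.assoc, hd]
    simp
  · rw [← cancel_epi r, reassoc_of% hd]
    simp [w]

theorem EpiCl.hasLift_of_monCl {U V : A → Prop} (hUV : IsCompleteCotorsionPair U V)
    {X Y Z W : A} {h : X ⟶ Y} (hh : MonCl U h) {r : Z ⟶ W} (hr : EpiCl V r) : HasLift h r := by
  intro f g sq
  have : Epi r := hr.1
  obtain ⟨s, hs, hs'⟩ := hUV.exists_section_s1 hh (IsSES.of_pullback r g) hr.2
    (pullback.lift f h sq.symm) (pullback.lift_snd _ _ _)
  refine ⟨s ≫ pullback.fst r g, by rw [reassoc_of% hs, pullback.lift_fst], ?_⟩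
  rw [Category.assoc, pullback.condition, reassoc_of% hs']

theorem IsSES.epiCl {U V : A → Prop} (hUV : IsCompleteCotorsionPair U V) {X Y Z : A}
    {i : X ⟶ Y} {p : Y ⟶ Z} (hS : IsSES i p) (hX : V X) : EpiCl V p := by
  obtain ⟨w, hS⟩ := hS
  exact ⟨hS.epi_g, hUV.isoV (hS.fIsKernel.conePointUniqueUpToIso (limit.isLimit _)) hX⟩

open ZeroObject in
theorem MonCl.of_hasLift {U V : A → Prop} (hUV : IsCompleteCotorsionPair U V)
    {X Y : A} {h : X ⟶ Y} (H : ∀ {Z W : A} (r : Z ⟶ W), EpiCl V r → HasLift h r) :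
    MonCl U h := by
  constructor
  · obtain ⟨V', _, i, _, _, hV', _, hS⟩ := hUV.complete_right X
    have : Mono i := hS.mono_f
    have hr : EpiCl V (0 : V' ⟶ 0) :=
      ⟨inferInstance, hUV.isoV kernelZeroIsoSource.symm hV'⟩
    obtain ⟨t, ht, _⟩ := H _ hr i 0 (by simp)
    have : Mono (h ≫ t) := by rw [ht]; infer_instance
    exact mono_of_mono h t
  · obtain ⟨_, _, i, p, hU', hV', hS⟩ := hUV.complete_left (cokernel h)
    obtain ⟨t, ht, ht'⟩ := H p (hS.epiCl hUV hV') 0 (cokernel.π h) (by simp)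
    exact hUV.summandU (cokernel.desc h t ht) p (by ext; simp [ht']) hU'

/-- For a complete cotorsion pair `(U, V)` in an abelian category,
`Mon(U) = ^□(Epi(V))`. -/
theorem stmt1 (U V : A → Prop) (hUV : IsCompleteCotorsionPair U V)
    {X Y : A} (h : X ⟶ Y) :
    MonCl U h ↔ (∀ {Z W : A} (r : Z ⟶ W), EpiCl V r → HasLift h r) :=
  ⟨fun hh _ _ _ hr => EpiCl.hasLift_of_monCl hUV hh hr, fun H => MonCl.of_hasLift hUV H⟩
end

section
/- Let A be an abelian category and let (U, V) be a complete cotorsion pair in A. Then Epi(V) = (Mon(U))^□, i.e., a morphism h lies in Epi(V) if and only if h has the right lifting property with respect to every morphism in Mon(U). -/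
open CategoryTheory CategoryTheory.Limits

universe v u

variable {A : Type u} [Category.{v} A] [Abelian A]

/-- Let `k : K ⟶ P` be the kernel of the epimorphism `p : P ⟶ W`, and let `s : Z ⟶ P` be a partial
section of `p` over a monomorphism `l : Z ⟶ W`. Then `K ⟶ P/Z ⟶ W/Z` is short exact. -/
theorem isSES_cokernel_of_partial_section {K P W Z : A} (k : K ⟶ P) (p : P ⟶ W) (hkp : IsSES k p)
    (l : Z ⟶ W) [Mono l] (s : Z ⟶ P) (hs : s ≫ p = l) :
    IsSES (k ≫ cokernel.π s)
      (cokernel.desc s (p ≫ cokernel.π l) (by rw [reassoc_of% hs, cokernel.condition])) := by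
  obtain ⟨w, hSE⟩ := hkp
  have hk : Mono k := hSE.mono_f
  have hp : Epi p := hSE.epi_g
  have hms : Mono s := by
    have : Mono (s ≫ p) := by rw [hs]; infer_instance
    exact mono_of_mono s p
  have exact_l : (ShortComplex.mk l _ (cokernel.condition l)).Exact :=
    ShortComplex.exact_cokernel l
  have exact_s : (ShortComplex.mk s _ (cokernel.condition s)).Exact :=
    ShortComplex.exact_cokernel s
  refine ⟨by simp [reassoc_of% w], ?_⟩
  refine { exact := ?_, mono_f := ?_, epi_g := ?_ }
  · rw [ShortComplex.exact_iff_exact_up_to_refinements]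
    intro T x hx
    dsimp at x hx
    obtain ⟨T', q, hq, z, hz⟩ := surjective_up_to_refinements_of_epi (cokernel.π s) x
    have hzl : (z ≫ p) ≫ cokernel.π l = 0 := by
      have := q ≫= hx
      rw [reassoc_of% hz] at this
      simpa using this
    obtain ⟨y, hy⟩ := exact_l.lift' (z ≫ p) hzl
    dsimp at y hy
    obtain ⟨u, hu⟩ := hSE.exact.lift' (z - y ≫ s) (by simp [hs, hy])
    dsimp at u hu
    exact ⟨T', q, hq, u, by simp [reassoc_of% hu, hz]⟩
  · refine Preadditive.mono_of_cancel_zero _ fun {T} x hx => ?_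
    obtain ⟨y, hy⟩ := exact_s.lift' (x ≫ k) (by simpa using hx)
    dsimp at x y hy
    have hyl : y ≫ l = 0 := by rw [← hs, reassoc_of% hy, w, comp_zero]
    rw [zero_of_comp_mono l hyl, zero_comp] at hy
    exact zero_of_comp_mono k hy.symm
  · have : Epi (cokernel.π s ≫ cokernel.desc s (p ≫ cokernel.π l)
        (by rw [reassoc_of% hs, cokernel.condition])) := by
      rw [cokernel.π_desc]; infer_instance
    exact epi_of_epi (cokernel.π s) _

/-- A retraction of the kernel which vanishes on a partial section extends that partial section
to a section. -/
theorem exists_section_of_retraction {K P W Z : A} {k : K ⟶ P} {p : P ⟶ W} (hkp : IsSES k p)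
    (s : Z ⟶ P) (r : P ⟶ K) (hr : k ≫ r = 𝟙 K) (hsr : s ≫ r = 0) :
    ∃ t : W ⟶ P, t ≫ p = 𝟙 W ∧ (s ≫ p) ≫ t = s := by
  obtain ⟨w, hSE⟩ := hkp
  have hp : Epi p := hSE.epi_g
  obtain ⟨t, ht⟩ := hSE.exact.desc' (𝟙 P - r ≫ k) (by simp [reassoc_of% hr])
  dsimp at t ht
  refine ⟨t, ?_, ?_⟩
  · rw [← cancel_epi p, reassoc_of% ht]
    simp [w]
  · rw [Category.assoc, ht]
    simp [reassoc_of% hsr]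

theorem isSES_kernel_pullback {X Y W : A} (h : X ⟶ Y) [Epi h] (g : W ⟶ Y) :
    IsSES (pullback.lift 0 (kernel.ι h) (by simp) : kernel h ⟶ pullback g h)
      (pullback.fst g h) := by
  refine ⟨pullback.lift_fst .., ?_⟩
  have hm : Mono (pullback.lift 0 (kernel.ι h) (by simp) : kernel h ⟶ pullback g h) := by
    have : Mono ((pullback.lift 0 (kernel.ι h) (by simp) : kernel h ⟶ pullback g h) ≫
        pullback.snd g h) := by
      rw [pullback.lift_snd]; infer_instance
    exact mono_of_mono _ (pullback.snd g h)
  have lift_eq {T : A} (x : T ⟶ pullback g h) (hx : x ≫ pullback.fst g h = 0) :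
      ∃ y : T ⟶ kernel h, y ≫ pullback.lift 0 (kernel.ι h) (by simp) = x := by
    refine ⟨kernel.lift h (x ≫ pullback.snd g h) ?_, ?_⟩
    · rw [Category.assoc, ← pullback.condition, reassoc_of% hx, zero_comp]
    · apply pullback.hom_ext
      · rw [Category.assoc, pullback.lift_fst, comp_zero, hx]
      · rw [Category.assoc, pullback.lift_snd, kernel.lift_ι]
  refine { exact := ?_, mono_f := hm, epi_g := by dsimp; infer_instance }
  rw [ShortComplex.exact_iff_exact_up_to_refinements]
  intro T x hx
  obtain ⟨y, hy⟩ := lift_eq x hx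
  exact ⟨T, 𝟙 T, inferInstance, y, by rw [Category.id_comp]; exact hy.symm⟩

namespace IsCompleteCotorsionPair

variable {U V : A → Prop}

theorem hasLift_of_monCl_of_epiCl (hUV : IsCompleteCotorsionPair U V) {X Y Z W : A}
    {l : Z ⟶ W} {h : X ⟶ Y} (hl : MonCl U l) (hh : EpiCl V h) : HasLift l h := by
  intro f g sq
  obtain ⟨_, hlU⟩ := hl
  obtain ⟨_, hhV⟩ := hh
  have hP := isSES_kernel_pullback h g
  have hs : pullback.lift l f sq ≫ pullback.fst g h = l := pullback.lift_fst ..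
  obtain ⟨r, hr⟩ := hUV.ext_zero _ _ hhV hlU
    (isSES_cokernel_of_partial_section _ _ hP l (pullback.lift l f sq) hs)
  obtain ⟨t, ht, hst⟩ := exists_section_of_retraction hP (pullback.lift l f sq)
    (cokernel.π _ ≫ r) (by simpa using hr) (by simp)
  rw [hs] at hst
  refine ⟨t ≫ pullback.snd g h, ?_, ?_⟩
  · rw [reassoc_of% hst, pullback.lift_snd]
  · rw [Category.assoc, ← pullback.condition, reassoc_of% ht]

theorem monCl_of_isSES (hUV : IsCompleteCotorsionPair U V) {X Y Z : A} {i : X ⟶ Y} {p : Y ⟶ Z}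
    (hip : IsSES i p) (hZ : U Z) : MonCl U i := by
  obtain ⟨w, hSE⟩ := hip
  exact ⟨hSE.mono_f,
    hUV.isoU (hSE.gIsCokernel.coconePointUniqueUpToIso (colimit.isColimit _)) hZ⟩

open scoped ZeroObject in
theorem epiCl_of_hasLift (hUV : IsCompleteCotorsionPair U V) {X Y : A} {h : X ⟶ Y}
    (hh : ∀ {Z W : A} (l : Z ⟶ W), MonCl U l → HasLift l h) : EpiCl V h := by
  constructor
  · obtain ⟨V', U', i, p, hU', -, _, hSE⟩ := hUV.complete_left Y
    have hp : Epi p := hSE.epi_g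
    have hzero : MonCl U (0 : (0 : A) ⟶ U') :=
      ⟨inferInstance, hUV.isoU cokernelZeroIsoTarget.symm hU'⟩
    obtain ⟨t, -, ht⟩ := hh _ hzero 0 p (by simp)
    have : Epi (t ≫ h) := by rwa [ht]
    exact epi_of_epi t h
  · obtain ⟨V', U', i, p, hU', hV', hip⟩ := hUV.complete_right (kernel h)
    obtain ⟨t, hit, hth⟩ := hh i (hUV.monCl_of_isSES hip hU') (kernel.ι h) 0 (by simp)
    refine hUV.summandV i (kernel.lift h t hth) ?_ hV'
    rw [← cancel_mono (kernel.ι h)]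
    simpa using hit

end IsCompleteCotorsionPair

/-- For a complete cotorsion pair `(U, V)` in an abelian category,
`Epi(V) = (Mon(U))^□`. -/
theorem stmt2 (U V : A → Prop) (hUV : IsCompleteCotorsionPair U V)
    {X Y : A} (h : X ⟶ Y) :
    EpiCl V h ↔ (∀ {Z W : A} (l : Z ⟶ W), MonCl U l → HasLift l h) :=
  ⟨fun hh _ _ _ hl => hUV.hasLift_of_monCl_of_epiCl hl hh, hUV.epiCl_of_hasLift⟩
end

section
/- Let A be an abelian category and let U be a class of objects of A closed under isomorphisms. Then the following are equivalent: (1) U is closed under kernels of epimorphisms, i.e., for every short exact sequence 0 → A → B → C → 0 with B, C ∈ U one has A ∈ U; (2) Mon(U) satisfies the left cancellation property. -/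
open CategoryTheory CategoryTheory.Limits

universe v u

variable {A : Type u} [Category.{v} A] [Abelian A]

/-- For a composable pair with `β` a monomorphism,
`0 ⟶ coker α ⟶ coker (α ≫ β) ⟶ coker β ⟶ 0` is short exact. -/
lemma isSES_cokernel_map {X Y Z : A} (α : X ⟶ Y) (β : Y ⟶ Z) [Mono β] :
    IsSES (cokernel.map α (α ≫ β) (𝟙 _) β (by simp))
      (cokernel.map (α ≫ β) β α (𝟙 _) (by simp)) := by
  have hex := kernelCokernelCompSequence_exact α β
  have hmono : Mono (cokernel.map α (α ≫ β) (𝟙 _) β (by simp)) :=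
    (hex.exact 2).mono_g ((isZero_kernel_of_mono β).eq_of_src _ _)
  have hepi : Epi (cokernel.map (α ≫ β) β α (𝟙 _) (by simp)) := inferInstance
  exact ⟨hex.zero 3, { exact := hex.exact 3, mono_f := hmono, epi_g := hepi }⟩

/-- `U` is closed under kernels of epimorphisms if and only if `Mon(U)` satisfies the
left cancellation property. -/
theorem stmt7 (U : A → Prop) (hU : ∀ {X Y : A}, (X ≅ Y) → U X → U Y) :
    (∀ {X Y Z : A} (i : X ⟶ Y) (p : Y ⟶ Z), IsSES i p → U Y → U Z → U X)
      ↔ LeftCancel (MonCl U) := by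
  constructor
  · intro hker X Y Z α β hαβ hβ
    have : Mono β := hβ.1
    have : Mono (α ≫ β) := hαβ.1
    exact ⟨mono_of_mono α β, hker _ _ (isSES_cokernel_map α β) hαβ.2 hβ.2⟩
  · rintro hcancel X Y Z i p ⟨w, hS⟩ hY hZ
    have : Mono i := hS.mono_f
    obtain ⟨O, hO⟩ := HasZeroObject.zero (C := A)
    have hzero (W : A) : Mono (0 : O ⟶ W) := ⟨fun _ _ _ => hO.eq_of_tgt _ _⟩
    have hi : MonCl U i :=
      ⟨inferInstance, hU (hS.gIsCokernel.coconePointUniqueUpToIso (colimit.isColimit _)) hZ⟩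
    have hcomp : MonCl U ((0 : O ⟶ X) ≫ i) := by
      rw [zero_comp]
      exact ⟨hzero Y, hU cokernelZeroIsoTarget.symm hY⟩
    exact hU cokernelZeroIsoTarget (hcancel _ i hcomp hi).2
end

section
/- Let A be an abelian category and let V be a class of objects of A closed under isomorphisms. Then the following are equivalent: (1) V is closed under cokernels of monomorphisms, i.e., for every short exact sequence 0 → A → B → C → 0 with A, B ∈ V one has C ∈ V; (2) Epi(V) satisfies the right cancellation property. -/
open CategoryTheory CategoryTheory.Limits

universe v u

variable {A : Type u} [Category.{v} A] [Abelian A]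

/-- For an epimorphism `α`, the sequence `0 → ker α → ker (β ∘ α) → ker β → 0` is short exact. -/
lemma isSES_kernel_comp {X Y Z : A} (α : X ⟶ Y) (β : Y ⟶ Z) [Epi α] :
    IsSES (kernel.map α (α ≫ β) (𝟙 X) β (by simp))
      (kernel.map (α ≫ β) β α (𝟙 Z) (by simp)) := by
  have hseq := kernelCokernelCompSequence_exact α β
  have hz : IsZero (cokernel α) := isZero_cokernel_of_epi α
  refine ⟨by ext; simp, ?_⟩
  have hepi : Epi (kernel.map (α ≫ β) β α (𝟙 Z) (by simp)) :=
    (hseq.exact 1).epi_f (hz.eq_of_tgt _ _)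
  have hmono : Mono (kernel.map α (α ≫ β) (𝟙 X) β (by simp)) :=
    inferInstanceAs (Mono ((kernelCokernelCompSequence α β).map' 0 1))
  exact { exact := hseq.exact 0, mono_f := hmono, epi_g := hepi }

/-- `V` is closed under cokernels of monomorphisms if and only if `Epi(V)` satisfies
the right cancellation property. -/
theorem stmt8 (V : A → Prop) (hV : ∀ {X Y : A}, (X ≅ Y) → V X → V Y) :
    (∀ {X Y Z : A} (i : X ⟶ Y) (p : Y ⟶ Z), IsSES i p → V X → V Y → V Z)
      ↔ RightCancel (EpiCl V) := by
  constructor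
  · intro h X Y Z α β hαβ hα
    have := hα.1
    have := hαβ.1
    exact ⟨epi_of_epi α β, h _ _ (isSES_kernel_comp α β) hα.2 hαβ.2⟩
  · intro h X Y Z i p hip hX hY
    obtain ⟨w, hs⟩ := hip
    have hp : Epi p := hs.epi_g
    have hpV : EpiCl V p :=
      ⟨hp, hV (hs.fIsKernel.conePointUniqueUpToIso (limit.isLimit _)) hX⟩
    obtain ⟨O, hO⟩ := HasZeroObject.zero (C := A)
    have hzero (W : A) : Epi (0 : W ⟶ O) := hO.epi _
    have hcomp : EpiCl V (p ≫ (0 : Z ⟶ O)) := by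
      rw [comp_zero]
      exact ⟨hzero Y, hV kernelZeroIsoSource.symm hY⟩
    exact hV kernelZeroIsoSource (h p 0 hcomp hpV).2
end

section
/- Let A be an abelian category and let U and V be classes of objects of A, each closed under isomorphisms, such that (Mon(U), Epi(V)) is a weak factorization system on A. Then Mon(U) satisfies the left cancellation property if and only if Epi(V) satisfies the right cancellation property. -/
open CategoryTheory CategoryTheory.Limits

universe v u

variable {A : Type u} [Category.{v} A] [Abelian A]

theorem MonCl.pullback_fst {U : A → Prop} (hU : ∀ {X Y : A}, (X ≅ Y) → U X → U Y)
    {X Y Z : A} (q : Z ⟶ Y) (l : X ⟶ Y) [Epi q] (hl : MonCl U l) :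
    MonCl U (pullback.fst q l) := by
  have := hl.1
  have sq := IsPullback.of_hasPullback q l
  have := Abelian.mono_cokernel_map_of_isPullback sq
  have : Epi (cokernel.map _ _ _ _ sq.w) := by
    have : Epi (cokernel.π (pullback.fst q l) ≫ cokernel.map _ _ _ _ sq.w) := by
      rw [cokernel.π_desc]
      infer_instance
    exact epi_of_epi (cokernel.π (pullback.fst q l)) _
  have := isIso_of_mono_of_epi (cokernel.map _ _ _ _ sq.w)
  exact ⟨inferInstance, hU (asIso (cokernel.map _ _ _ _ sq.w)).symm hl.2⟩

theorem EpiCl.pushout_inr {V : A → Prop} (hV : ∀ {X Y : A}, (X ≅ Y) → V X → V Y)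
    {Z W T : A} (r : Z ⟶ W) (j : Z ⟶ T) [Mono j] (hr : EpiCl V r) :
    EpiCl V (pushout.inr r j) := by
  have := hr.1
  have sq := IsPushout.of_hasPushout r j
  have := Abelian.epi_kernel_map_of_isPushout sq
  have : Mono (kernel.map _ _ _ _ sq.w) := by
    have : Mono (kernel.map _ _ _ _ sq.w ≫ kernel.ι (pushout.inr r j)) := by
      rw [kernel.lift_ι]
      infer_instance
    exact mono_of_mono _ (kernel.ι (pushout.inr r j))
  have := isIso_of_mono_of_epi (kernel.map _ _ _ _ sq.w)
  exact ⟨inferInstance, hV (asIso (kernel.map _ _ _ _ sq.w)) hr.2⟩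

open scoped ZeroObject in
theorem rightCancel_epiCl_of_leftCancel {U V : A → Prop}
    (hU : ∀ {X Y : A}, (X ≅ Y) → U X → U Y)
    (hwfs : IsWFS (MonCl U) (EpiCl V)) (hL : LeftCancel (MonCl U)) :
    RightCancel (EpiCl V) := by
  obtain ⟨hLift, hRLift, hFact⟩ := hwfs
  intro P Q R α β hαβ hα
  refine (hRLift β).2 fun {X Y} l hl f g w => ?_
  obtain ⟨Z, z, q, hz, hq, -⟩ := hFact (0 : (0 : A) ⟶ Y)
  have := hl.1
  have := hq.1
  have hι := MonCl.pullback_fst hU q l hl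
  have hN : MonCl U (0 : (0 : A) ⟶ pullback q l) := by
    refine hL _ (pullback.fst q l) ?_ hι
    rwa [(isZero_zero A).eq_of_src (0 ≫ pullback.fst q l) z]
  obtain ⟨h, -, hh⟩ := (hLift _).1 hN α hα 0 (pullback.snd q l ≫ f)
    ((isZero_zero A).eq_of_src _ _)
  obtain ⟨k, hk₁, hk₂⟩ := (hLift _).1 hι (α ≫ β) hαβ h (q ≫ g) (by
    rw [reassoc_of% hh, ← w, pullback.condition_assoc])
  have hc : pullback.fst q l ≫ k ≫ α = pullback.snd q l ≫ f := by
    rw [reassoc_of% hk₁, hh]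
  have hker : kernel.ι q ≫ k ≫ α = 0 := by
    have := pullback.lift (kernel.ι q) 0 (by simp) ≫= hc
    rwa [pullback.lift_fst_assoc, pullback.lift_snd_assoc, zero_comp] at this
  refine ⟨Abelian.epiDesc q (k ≫ α) hker, ?_, ?_⟩
  · rw [← cancel_epi (pullback.snd q l), ← pullback.condition_assoc,
      Abelian.comp_epiDesc, hc]
  · rw [← cancel_epi q, Abelian.comp_epiDesc_assoc, Category.assoc, hk₂]

open scoped ZeroObject in
theorem leftCancel_monCl_of_rightCancel {U V : A → Prop}
    (hV : ∀ {X Y : A}, (X ≅ Y) → V X → V Y)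
    (hwfs : IsWFS (MonCl U) (EpiCl V)) (hR : RightCancel (EpiCl V)) :
    LeftCancel (MonCl U) := by
  obtain ⟨hLift, -, hFact⟩ := hwfs
  intro X Y T α β hαβ hβ
  refine (hLift α).2 fun {Z W} r hr f g w => ?_
  obtain ⟨I, j, z, hj, hz, -⟩ := hFact (0 : Z ⟶ (0 : A))
  have := hr.1
  have := hj.1
  have hι := EpiCl.pushout_inr hV r j hr
  have hN : EpiCl V (0 : pushout r j ⟶ (0 : A)) := by
    refine hR (pushout.inr r j) _ ?_ hι
    rwa [(isZero_zero A).eq_of_tgt (pushout.inr r j ≫ 0) z]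
  obtain ⟨h, hh, -⟩ := (hLift _).1 hβ _ hN (g ≫ pushout.inl r j) 0
    ((isZero_zero A).eq_of_tgt _ _)
  obtain ⟨k, hk₁, hk₂⟩ := (hLift _).1 hαβ _ hι (f ≫ j) h (by
    rw [Category.assoc, hh, reassoc_of% w, pushout.condition, Category.assoc])
  have hc : (β ≫ k) ≫ pushout.inr r j = g ≫ pushout.inl r j := by
    rw [Category.assoc, hk₂, hh]
  have hcoker : (β ≫ k) ≫ cokernel.π j = 0 := by
    have := hc =≫ pushout.desc 0 (cokernel.π j) (by simp)
    rwa [Category.assoc, pushout.inr_desc, Category.assoc g, pushout.inl_desc, comp_zero] at this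
  refine ⟨Abelian.monoLift j (β ≫ k) hcoker, ?_, ?_⟩
  · rw [← cancel_mono j, Category.assoc, Abelian.monoLift_comp, ← hk₁, Category.assoc]
  · rw [← cancel_mono (pushout.inl r j), Category.assoc, pushout.condition,
      Abelian.monoLift_comp_assoc, hc]

/-- If `(Mon(U), Epi(V))` is a weak factorization system on an abelian category, then
`Mon(U)` satisfies the left cancellation property if and only if `Epi(V)` satisfies the
right cancellation property. -/
theorem stmt9 (U V : A → Prop)
    (hU : ∀ {X Y : A}, (X ≅ Y) → U X → U Y)
    (hV : ∀ {X Y : A}, (X ≅ Y) → V X → V Y)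
    (hwfs : IsWFS (MonCl U) (EpiCl V)) :
    LeftCancel (MonCl U) ↔ RightCancel (EpiCl V) :=
  ⟨rightCancel_epiCl_of_leftCancel hU hwfs, leftCancel_monCl_of_rightCancel hV hwfs⟩
end

section
/- Let A be an abelian category, and let U, Ũ, V, Ṽ be classes of objects of A, each closed under isomorphisms, such that (Mon(U), Epi(Ṽ)) and (Mon(Ũ), Epi(V)) are compatible weak factorization systems on A. Let W denote the class of morphisms α that can be written α = r ∘ l with l ∈ Mon(Ũ) and r ∈ Epi(Ṽ). If a composition g = f ∘ h lies in W and f ∈ Epi(Ṽ), then h ∈ W. -/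
open CategoryTheory CategoryTheory.Limits

universe v u

section AbelianDefs

/-- In a preadditive category, suppose `s = ρ ≫ r` lies in the right class of a weak factorization
system and `ρ` has a section `j`. Then `ρ` lies in the right class. -/
theorem IsWFS.right_of_section {C : Type u} [Category.{v} C] [Preadditive C]
    {L R : MorphismProperty C} (hLR : IsWFS L R) {X Y Z : C} {j : X ⟶ Y} {ρ : Y ⟶ X} {r : X ⟶ Z}
    (hj : j ≫ ρ = 𝟙 X) (hs : R (ρ ≫ r)) : R ρ := by
  refine (hLR.2.1 ρ).2 fun a ha x y hxy => ?_
  obtain ⟨t, ht, -⟩ := (hLR.2.1 _).1 hs a ha x (y ≫ r) (by rw [reassoc_of% hxy])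
  refine ⟨t + (y - t ≫ ρ) ≫ j, ?_, ?_⟩
  · simp [Preadditive.comp_add, Preadditive.sub_comp, reassoc_of% ht, reassoc_of% hxy, ht]
  · simp [Preadditive.add_comp, Preadditive.sub_comp, hj]

theorem IsWFS.left_comp {C : Type u} [Category.{v} C] {L R : MorphismProperty C}
    (hLR : IsWFS L R) {X Y Z : C} {f : X ⟶ Y} {g : Y ⟶ Z} (hf : L f) (hg : L g) :
    L (f ≫ g) := by
  refine (hLR.1 _).2 fun r hr x y hxy => ?_
  obtain ⟨t, ht, ht'⟩ := (hLR.1 f).1 hf r hr x (g ≫ y) (by simpa using hxy)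
  obtain ⟨t₂, ht₂, ht₂'⟩ := (hLR.1 g).1 hg r hr t y ht'.symm
  exact ⟨t₂, by simp [ht₂, ht], ht₂'⟩

theorem IsWFS.right_comp {C : Type u} [Category.{v} C] {L R : MorphismProperty C}
    (hLR : IsWFS L R) {X Y Z : C} {f : X ⟶ Y} {g : Y ⟶ Z} (hf : R f) (hg : R g) :
    R (f ≫ g) := by
  refine (hLR.2.1 _).2 fun l hl x y hxy => ?_
  obtain ⟨t, ht, ht'⟩ := (hLR.2.1 g).1 hg l hl (x ≫ f) y (by simpa using hxy)
  obtain ⟨t₂, ht₂, ht₂'⟩ := (hLR.2.1 f).1 hf l hl x t ht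
  exact ⟨t₂, ht₂, by rw [← Category.assoc, ht₂', ht']⟩

theorem IsWFS.left_id {C : Type u} [Category.{v} C] {L R : MorphismProperty C}
    (hLR : IsWFS L R) (X : C) : L (𝟙 X) :=
  (hLR.1 _).2 fun _ _ x _ hxy => ⟨x, Category.id_comp x, by simpa using hxy.symm⟩

/-- If a morphism factors as `Lt` followed by `Rt`, then the second factor of every factorization
of it as `Lt` followed by `R` lies in `Rt`. -/
theorem CompatWFS.right_of_factorization {C : Type u} [Category.{v} C] [Preadditive C]
    {L Rt Lt R : MorphismProperty C} (h1 : IsWFS L Rt) (h2 : IsWFS Lt R)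
    (hc : CompatWFS L Rt Lt R) {X P Q Z : C} {l : X ⟶ P} {r : P ⟶ Z} {i : X ⟶ Q} {q : Q ⟶ Z}
    (hl : Lt l) (hr : Rt r) (hi : Lt i) (hq : R q) (w : l ≫ r = i ≫ q) : Rt q := by
  obtain ⟨t, ht, ht'⟩ := (h2.1 l).1 hl q hq i r w
  obtain ⟨N, j, p, hj, hp, rfl⟩ := h2.2.2 t
  have hpt : Rt p := hc.2.2 (l ≫ j) p (h2.left_comp hl hj) hp (by simpa [ht] using hi)
  have hs : R (p ≫ q) := h2.right_comp hp hq
  obtain ⟨ρ, hρ, hρ'⟩ := (h1.1 j).1 (hc.1 j hj) r hr (𝟙 P) (p ≫ q) (by simpa using ht')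
  have hρR : R ρ := h2.right_of_section hρ (hρ' ▸ hs)
  have hρt : Rt ρ := hc.2.2 j ρ hj hρR (hρ ▸ h2.left_id P)
  have hst : Rt (p ≫ q) := hρ' ▸ h1.right_comp hρt hr
  exact (hc.2.1 p q hp hq).2.1 hpt hst

variable {A : Type u} [Category.{v} A] [Abelian A]

end AbelianDefs

variable {A : Type u} [Category.{v} A] [Abelian A]

/-- Let `(Mon(U), Epi(Ṽ))` and `(Mon(Ũ), Epi(V))` be compatible weak factorization
systems on an abelian category, and let `W` be the class of morphisms factoring as a
morphism of `Mon(Ũ)` followed by a morphism of `Epi(Ṽ)`. If `h ≫ f ∈ W` and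
`f ∈ Epi(Ṽ)`, then `h ∈ W`. -/
theorem stmt11 (U Ut V Vt : A → Prop)
    (hU : ∀ {X Y : A}, (X ≅ Y) → U X → U Y)
    (hUt : ∀ {X Y : A}, (X ≅ Y) → Ut X → Ut Y)
    (hV : ∀ {X Y : A}, (X ≅ Y) → V X → V Y)
    (hVt : ∀ {X Y : A}, (X ≅ Y) → Vt X → Vt Y)
    (h1 : IsWFS (MonCl U) (EpiCl Vt)) (h2 : IsWFS (MonCl Ut) (EpiCl V))
    (hc : CompatWFS (MonCl U) (EpiCl Vt) (MonCl Ut) (EpiCl V))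
    {X Y Z : A} (h : X ⟶ Y) (f : Y ⟶ Z)
    (hf : EpiCl Vt f)
    (hW : ∃ (P : A) (l : X ⟶ P) (r : P ⟶ Z), MonCl Ut l ∧ EpiCl Vt r ∧ l ≫ r = h ≫ f) :
    ∃ (P : A) (l : X ⟶ P) (r : P ⟶ Y), MonCl Ut l ∧ EpiCl Vt r ∧ l ≫ r = h := by
  have hle : ∀ {X Y : A} (g : X ⟶ Y), EpiCl Vt g → EpiCl V g := fun g hg =>
    (h2.2.1 g).2 fun l hl => (h1.2.1 g).1 hg l (hc.1 l hl)
  obtain ⟨P, l, r, hl, hr, hlr⟩ := hW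
  obtain ⟨Q, i, p, hi, hp, rfl⟩ := h2.2.2 h
  have hpf : EpiCl Vt (p ≫ f) :=
    hc.right_of_factorization h1 h2 hl hr hi (h2.right_comp hp (hle f hf))
      (hlr.trans (Category.assoc i p f))
  exact ⟨Q, i, p, hi, (hc.2.1 p f hp (hle f hf)).2.2 hf hpf, rfl⟩
end

section
/- Let T be a triangulated category, U a class of objects of T, and g: X → Y a morphism fitting into a distinguished triangle K → X →g Y → K[1]. If every morphism f fitting into a distinguished triangle with third term (cone) in U has the left lifting property with respect to g, then Hom(U, K[1]) = 0 for every U ∈ U. -/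
open CategoryTheory CategoryTheory.Limits CategoryTheory.Pretriangulated

universe v u

section TriangulatedDefs

variable {T : Type u} [Category.{v} T] [HasZeroObject T] [HasShift T ℤ]
  [Preadditive T] [∀ n : ℤ, (shiftFunctor T n).Additive] [Pretriangulated T]

/-- `Infl(U)`: morphisms `f : X ⟶ Y` fitting into a distinguished triangle
`X → Y → Z → X[1]` with cone `Z ∈ U`. -/
def InflCl (U : T → Prop) : MorphismProperty T :=
  fun X Y f => ∃ (Z : T) (g : Y ⟶ Z) (h : Z ⟶ X⟦(1:ℤ)⟧),
    Triangle.mk f g h ∈ (distTriang T) ∧ U Z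

/-- `Defl(V)`: morphisms `g : X ⟶ Y` fitting into a distinguished triangle
`W → X → Y → W[1]` with cocone `W ∈ V`. -/
def DeflCl (V : T → Prop) : MorphismProperty T :=
  fun X Y g => ∃ (W : T) (w : W ⟶ X) (h : Y ⟶ W⟦(1:ℤ)⟧),
    Triangle.mk w g h ∈ (distTriang T) ∧ V W

/-- `(U, V)` is a cotorsion pair on the triangulated category `T`: both classes closed
under isomorphisms and direct summands, `Hom(U, V[1]) = 0`, and every object admits the
two approximation triangles. -/
structure IsTriCotorsionPair (U V : T → Prop) : Prop where
  isoU : ∀ {X Y : T}, (X ≅ Y) → U X → U Y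
  isoV : ∀ {X Y : T}, (X ≅ Y) → V X → V Y
  summandU : ∀ {X Z : T} (i : X ⟶ Z) (r : Z ⟶ X), i ≫ r = 𝟙 X → U Z → U X
  summandV : ∀ {X Z : T} (i : X ⟶ Z) (r : Z ⟶ X), i ≫ r = 𝟙 X → V Z → V X
  hom_zero : ∀ {X Y : T}, U X → V Y → ∀ f : X ⟶ Y⟦(1:ℤ)⟧, f = 0
  tri_left : ∀ C : T, ∃ (V' U' : T) (i : V' ⟶ U') (p : U' ⟶ C) (h : C ⟶ V'⟦(1:ℤ)⟧),
    Triangle.mk i p h ∈ (distTriang T) ∧ U U' ∧ V V'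
  tri_right : ∀ C : T, ∃ (V' U' : T) (i : C ⟶ V') (p : V' ⟶ U') (h : U' ⟶ C⟦(1:ℤ)⟧),
    Triangle.mk i p h ∈ (distTriang T) ∧ U U' ∧ V V'

/-- `(U, V)` is a co-t-structure on `T`: `U[-1] ⊆ U`, `V[1] ⊆ V`,
`Hom(U[-1], V) = 0`, and every object `C` fits in a distinguished triangle
`X → C → Y → X[1]` with `X ∈ U[-1]` and `Y ∈ V`. -/
structure IsCoTStructure (U V : T → Prop) : Prop where
  shiftU : ∀ X : T, U X → U (X⟦(-1:ℤ)⟧)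
  shiftV : ∀ X : T, V X → V (X⟦(1:ℤ)⟧)
  hom_zero : ∀ {X Y : T}, U X → V Y → ∀ f : X⟦(-1:ℤ)⟧ ⟶ Y, f = 0
  exists_tri : ∀ C : T, ∃ (X Y : T) (i : X ⟶ C) (p : C ⟶ Y) (h : Y ⟶ X⟦(1:ℤ)⟧),
    Triangle.mk i p h ∈ (distTriang T) ∧ U (X⟦(1:ℤ)⟧) ∧ V Y

end TriangulatedDefs

variable {T : Type u} [Category.{v} T] [HasZeroObject T] [HasShift T ℤ]
  [Preadditive T] [∀ n : ℤ, (shiftFunctor T n).Additive] [Pretriangulated T]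
  [IsTriangulated T]

/-- If `g : X ⟶ Y` fits in a distinguished triangle `K → X → Y → K[1]` and every
morphism of `Infl(U)` has the left lifting property with respect to `g`, then
`Hom(U', K[1]) = 0` for every `U' ∈ U`. -/
theorem stmt13 (U : T → Prop) {K X Y : T} (k : K ⟶ X) (g : X ⟶ Y)
    (h : Y ⟶ K⟦(1:ℤ)⟧) (htri : Triangle.mk k g h ∈ (distTriang T))
    (hlift : ∀ {Z W : T} (f : Z ⟶ W), InflCl U f → HasLift f g) :
    ∀ {U' : T}, U U' → ∀ φ : U' ⟶ K⟦(1:ℤ)⟧, φ = 0 := by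
  intro U' hU' φ
  have hkg : k ≫ g = 0 := comp_distTriang_mor_zero₁₂ _ htri
  obtain ⟨E, f, p, hE⟩ := distinguished_cocone_triangle₂ φ
  obtain ⟨t, hft, -⟩ := hlift f ⟨U', p, φ, hE, hU'⟩ k 0 (by rw [hkg, comp_zero])
  have hφf : φ ≫ f⟦(1 : ℤ)⟧' = 0 := comp_distTriang_mor_zero₃₁ _ hE
  have hφk : φ ≫ k⟦(1 : ℤ)⟧' = 0 := by
    rw [← hft, Functor.map_comp, reassoc_of% hφf, zero_comp]
  obtain ⟨a, rfl⟩ : ∃ a : U' ⟶ Y, φ = a ≫ h := Triangle.coyoneda_exact₁ _ htri φ hφk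
  obtain ⟨b, -, rfl⟩ := hlift (0 : (HasZeroObject.zero' T).zero ⟶ U')
    ⟨U', 𝟙 U', 0, contractible_distinguished₁ U', hU'⟩ 0 a (by simp)
  have hgh : g ≫ h = 0 := comp_distTriang_mor_zero₂₃ _ htri
  rw [Category.assoc, hgh, comp_zero]
end

section
/- Let T be a triangulated category and let U be a class of objects of T closed under isomorphisms. Then the following are equivalent: (1) for every distinguished triangle A → B → C → A[1] with B, C ∈ U one has A ∈ U; (2) Infl(U) satisfies the left cancellation property. -/
open CategoryTheory CategoryTheory.Limits CategoryTheory.Pretriangulated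

universe v u

variable {T : Type u} [Category.{v} T] [HasZeroObject T] [HasShift T ℤ]
  [Preadditive T] [∀ n : ℤ, (shiftFunctor T n).Additive] [Pretriangulated T]
  [IsTriangulated T]

section

open scoped ZeroObject

/-- For `U` closed under isomorphisms, `0 ⟶ X` is in `Infl(U)` if and only if `X ∈ U`. -/
lemma inflCl_zero_iff {C : Type*} [Category* C] [HasZeroObject C] [HasShift C ℤ]
    [Preadditive C] [∀ n : ℤ, (shiftFunctor C n).Additive] [Pretriangulated C]
    {U : C → Prop} (hU : ∀ {X Y : C}, (X ≅ Y) → U X → U Y) (X : C) :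
    InflCl U (0 : (0 : C) ⟶ X) ↔ U X := by
  refine ⟨?_, fun hX ↦ ⟨X, 𝟙 X, 0, contractible_distinguished₁ X, hX⟩⟩
  rintro ⟨W, p, q, hW, hUW⟩
  have : IsIso p := (Triangle.isZero₁_iff_isIso₂ _ hW).1 (isZero_zero C)
  exact hU (asIso p).symm hUW

end

/-- `U` is closed under cocones of distinguished triangles with second and third terms
in `U` if and only if `Infl(U)` satisfies the left cancellation property. -/
theorem stmt14 (U : T → Prop) (hU : ∀ {X Y : T}, (X ≅ Y) → U X → U Y) :
    (∀ {X Y Z : T} (f : X ⟶ Y) (g : Y ⟶ Z) (h : Z ⟶ X⟦(1:ℤ)⟧),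
        Triangle.mk f g h ∈ (distTriang T) → U Y → U Z → U X)
      ↔ LeftCancel (InflCl U) := by
  constructor
  · rintro hcocone X Y Z α β ⟨C₁₃, v₁₃, w₁₃, h₁₃, hU₁₃⟩ ⟨C₂₃, v₂₃, w₂₃, h₂₃, hU₂₃⟩
    obtain ⟨C₁₂, v₁₂, w₁₂, h₁₂⟩ := distinguished_cocone_triangle α
    exact ⟨C₁₂, v₁₂, w₁₂, h₁₂,
      hcocone _ _ _ (Triangulated.someOctahedron rfl h₁₂ h₂₃ h₁₃).mem hU₁₃ hU₂₃⟩
  · intro hcancel X Y Z f g h hT hY hZ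
    rw [← inflCl_zero_iff hU] at hY ⊢
    exact hcancel 0 f (by rwa [zero_comp]) ⟨Z, g, h, hT, hZ⟩
end

section
/- Let T be a triangulated category and let (U, V) be a cotorsion pair on T. Then (Infl(U), Defl(V)) is a weak factorization system on T. -/
open CategoryTheory CategoryTheory.Limits CategoryTheory.Pretriangulated

universe v u

section Lifting

variable {T : Type u} [Category.{v} T] [HasZeroObject T] [HasShift T ℤ]
  [Preadditive T] [∀ n : ℤ, (shiftFunctor T n).Additive] [Pretriangulated T]

/-- If `Hom(U, V[1]) = 0`, then a morphism with cone in `U` has the left lifting property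
against a morphism with cocone in `V`. -/
lemma hasLift_of_infl_of_defl {U V : T → Prop}
    (hom_zero : ∀ {X Y : T}, U X → V Y → ∀ f : X ⟶ Y⟦(1:ℤ)⟧, f = 0)
    {X Y Z W : T} {l : X ⟶ Y} {r : Z ⟶ W} (hl : InflCl U l) (hr : DeflCl V r) :
    HasLift l r := by
  obtain ⟨A, g, h, hA, hUA⟩ := hl
  obtain ⟨B, w, k, hB, hVB⟩ := hr
  intro a b comm
  have hrk : r ≫ k = 0 := comp_distTriang_mor_zero₂₃ _ hB
  have hbk : b ≫ k = 0 := by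
    obtain ⟨c, hc⟩ := Triangle.yoneda_exact₂ _ hA (b ≫ k) (by
      change l ≫ b ≫ k = 0
      rw [← Category.assoc, comm, Category.assoc, hrk, comp_zero])
    exact hc.trans ((congrArg _ (hom_zero hUA hVB c)).trans comp_zero)
  obtain ⟨t₀, ht₀⟩ : ∃ t₀ : Y ⟶ Z, b = t₀ ≫ r := Triangle.coyoneda_exact₃ _ hB b hbk
  obtain ⟨s, hs⟩ : ∃ s : X ⟶ B, l ≫ t₀ - a = s ≫ w :=
    Triangle.coyoneda_exact₂ _ hB (l ≫ t₀ - a) (by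
      change (l ≫ t₀ - a) ≫ r = 0
      rw [Preadditive.sub_comp, Category.assoc, ← ht₀, comm, sub_self])
  obtain ⟨σ, hσ⟩ : ∃ σ : Y⟦(1:ℤ)⟧ ⟶ B⟦(1:ℤ)⟧, s⟦(1:ℤ)⟧' = (-l⟦(1:ℤ)⟧') ≫ σ :=
    Triangle.yoneda_exact₃ _ (rot_of_distTriang _ hA) (s⟦(1:ℤ)⟧') (hom_zero hUA hVB _)
  obtain ⟨s', rfl⟩ := (shiftFunctor T (1:ℤ)).map_surjective σ
  have hs' : s = -(l ≫ s') := by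
    apply (shiftFunctor T (1:ℤ)).map_injective
    rw [hσ, Functor.map_neg, Functor.map_comp, Preadditive.neg_comp]
  have hwr : w ≫ r = 0 := comp_distTriang_mor_zero₁₂ _ hB
  refine ⟨t₀ + s' ≫ w, ?_, ?_⟩
  · rw [Preadditive.comp_add, ← Category.assoc l s' w, ← neg_neg (l ≫ s'), ← hs',
      Preadditive.neg_comp, ← hs]
    abel
  · rw [Preadditive.add_comp, Category.assoc, hwr, comp_zero, add_zero, ht₀]

/-- The cone of a retract, relative to a fixed source, is a direct summand of the cone. -/
lemma InflCl.of_retract {U : T → Prop}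
    (summand : ∀ {X Z : T} (i : X ⟶ Z) (r : Z ⟶ X), i ≫ r = 𝟙 X → U Z → U X)
    {X Y M : T} {f : X ⟶ Y} {l : X ⟶ M} (t : Y ⟶ M) (r : M ⟶ Y)
    (hft : f ≫ t = l) (hlr : l ≫ r = f) (htr : t ≫ r = 𝟙 Y) (hl : InflCl U l) :
    InflCl U f := by
  obtain ⟨A, g, h, hA, hUA⟩ := hl
  obtain ⟨B, g', h', hB⟩ := distinguished_cocone_triangle f
  refine ⟨B, g', h', hB, ?_⟩
  let φ := completeDistinguishedTriangleMorphism _ _ hB hA (𝟙 X) t (hft.trans (Category.id_comp l).symm)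
  let ψ := completeDistinguishedTriangleMorphism _ _ hA hB (𝟙 X) r (hlr.trans (Category.id_comp f).symm)
  have hφψ : IsIso (φ ≫ ψ).hom₃ := by
    apply isIso₃_of_isIso₁₂ (φ ≫ ψ) hB hB
    · change IsIso (𝟙 X ≫ 𝟙 X)
      infer_instance
    · change IsIso (t ≫ r)
      rw [htr]
      infer_instance
  obtain ⟨e, he, -⟩ := hφψ.out
  exact summand φ.hom₃ (ψ.hom₃ ≫ e) ((Category.assoc _ _ _).symm.trans he) hUA

/-- The cocone of a retract, relative to a fixed target, is a direct summand of the cocone. -/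
lemma DeflCl.of_retract {V : T → Prop}
    (summand : ∀ {X Z : T} (i : X ⟶ Z) (r : Z ⟶ X), i ≫ r = 𝟙 X → V Z → V X)
    {X Y M : T} {g : X ⟶ Y} {r : M ⟶ Y} (l : X ⟶ M) (t : M ⟶ X)
    (hlr : l ≫ r = g) (htg : t ≫ g = r) (hlt : l ≫ t = 𝟙 X) (hr : DeflCl V r) :
    DeflCl V g := by
  obtain ⟨A, w, h, hA, hVA⟩ := hr
  obtain ⟨B, w', h', hB⟩ := distinguished_cocone_triangle₁ g
  refine ⟨B, w', h', hB, ?_⟩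
  obtain ⟨a, ha₁, ha₃⟩ := complete_distinguished_triangle_morphism₁ _ _ hB hA l (𝟙 Y)
    ((Category.comp_id g).trans hlr.symm)
  obtain ⟨b, hb₁, hb₃⟩ := complete_distinguished_triangle_morphism₁ _ _ hA hB t (𝟙 Y)
    ((Category.comp_id r).trans htg.symm)
  let φ : Triangle.mk w' g h' ⟶ Triangle.mk w r h :=
    { hom₁ := a, hom₂ := l, hom₃ := 𝟙 Y, comm₁ := ha₁
      comm₂ := (Category.comp_id g).trans hlr.symm
      comm₃ := ha₃ }
  let ψ : Triangle.mk w r h ⟶ Triangle.mk w' g h' :=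
    { hom₁ := b, hom₂ := t, hom₃ := 𝟙 Y, comm₁ := hb₁
      comm₂ := (Category.comp_id r).trans htg.symm
      comm₃ := hb₃ }
  have hφψ : IsIso (φ ≫ ψ).hom₁ := by
    apply isIso₁_of_isIso₂₃ (φ ≫ ψ) hB hB
    · change IsIso (l ≫ t)
      rw [hlt]
      infer_instance
    · change IsIso (𝟙 Y ≫ 𝟙 Y)
      infer_instance
  obtain ⟨e, he, -⟩ := hφψ.out
  exact summand φ.hom₁ (ψ.hom₁ ≫ e) ((Category.assoc _ _ _).symm.trans he) hVA

/-- If every object `C` sits in a distinguished triangle `V' → U' → C → V'[1]` with `U' ∈ U`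
and `V' ∈ V`, then every morphism factors as one with cone in `U` followed by one with
cocone in `V`. -/
lemma exists_infl_defl_factorization [IsTriangulated T] {U V : T → Prop}
    (tri : ∀ C : T, ∃ (V' U' : T) (i : V' ⟶ U') (p : U' ⟶ C) (h : C ⟶ V'⟦(1:ℤ)⟧),
      Triangle.mk i p h ∈ (distTriang T) ∧ U U' ∧ V V')
    {X Y : T} (f : X ⟶ Y) :
    ∃ (Z : T) (l : X ⟶ Z) (r : Z ⟶ Y), InflCl U l ∧ DeflCl V r ∧ l ≫ r = f := by
  obtain ⟨C, g, h, hC⟩ := distinguished_cocone_triangle f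
  obtain ⟨V', U', i, p, q, hq, hU', hV'⟩ := tri C
  obtain ⟨M, w, r, hM⟩ := distinguished_cocone_triangle₂ (g ≫ q)
  let o := Triangulated.someOctahedron' rfl hC (rot_of_distTriang _ hq)
    (rot_of_distTriang _ hM)
  exact ⟨M, o.m₁, r, ⟨U', o.m₃, _, o.mem, hU'⟩, ⟨V', w, _, hM, hV'⟩, o.comm₁⟩

end Lifting

variable {T : Type u} [Category.{v} T] [HasZeroObject T] [HasShift T ℤ]
  [Preadditive T] [∀ n : ℤ, (shiftFunctor T n).Additive] [Pretriangulated T]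
  [IsTriangulated T]

/-- For a cotorsion pair `(U, V)` on a triangulated category, the pair
`(Infl(U), Defl(V))` is a weak factorization system. -/
theorem stmt15 (U V : T → Prop) (hUV : IsTriCotorsionPair U V) :
    IsWFS (InflCl U) (DeflCl V) := by
  refine ⟨fun f => ⟨fun hf _ _ r hr => hasLift_of_infl_of_defl hUV.hom_zero hf hr, fun hf => ?_⟩,
    fun g => ⟨fun hg _ _ l hl => hasLift_of_infl_of_defl hUV.hom_zero hl hg, fun hg => ?_⟩,
    fun h => exists_infl_defl_factorization hUV.tri_left h⟩
  · obtain ⟨M, l, r, hl, hr, rfl⟩ := exists_infl_defl_factorization hUV.tri_left f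
    obtain ⟨t, ht₁, ht₂⟩ := hf r hr l (𝟙 _) (Category.comp_id _)
    exact InflCl.of_retract hUV.summandU t r ht₁ rfl ht₂ hl
  · obtain ⟨M, l, r, hl, hr, rfl⟩ := exists_infl_defl_factorization hUV.tri_left g
    obtain ⟨t, ht₁, ht₂⟩ := hg l hl (𝟙 _) r (Category.id_comp _).symm
    exact DeflCl.of_retract hUV.summandV l t rfl ht₂ ht₁ hr
end
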